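/- arXiv:2510.16268 — 4 statements merged into one kernel-verified Lean document; each statement's English description precedes it below -/
import Mathlib

section
/- Let X = (1/4, 1] with the usual metric and let T, f, g be as follows: T(x) = 1/2 for 1/4 < x < 2/3 and T(x) = 1 − x/2 for 2/3 ≤ x ≤ 1; f(x) = 1 for 1/4 < x < 2/3 and f(x) = 4/3 − x for 2/3 ≤ x ≤ 1; g(x) = 1/3 for 1/4 < x < 2/3 and g(x) = 4/3 − x for 2/3 ≤ x ≤ 1. Then T is (f,g)-weakly contractive with ψ(t) = t²/(1+t), but for every ψ ∈ Ψ there exist x, y ∈ X (namely any x, y ∈ (1/4, 2/3)) with d(gx, Ty) > d(fx, fy) − ψ(d(fx, fy)); hence the (f,g)-weak contractive condition does not imply the Azam–Shakeel condition d(gx,Ty) ≤ d(fx,fy) − ψ(d(fx,fy)). -/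
open Set

/-- The class Ψ of altering-distance functions. -/
def IsPsi (ψ : ℝ → ℝ) : Prop :=
  ContinuousOn ψ (Set.Ici 0) ∧ MonotoneOn ψ (Set.Ici 0) ∧
  (∀ t ∈ Set.Ici (0 : ℝ), 0 ≤ ψ t) ∧ (∀ t : ℝ, 0 < t → 0 < ψ t) ∧
  ψ 0 = 0 ∧ Filter.Tendsto ψ Filter.atTop Filter.atTop

/-- Example 1.9: `T` on `X = (1/4, 1]`. -/
noncomputable def T15 : ℝ → ℝ := fun x => if x < 2 / 3 then 1 / 2 else 1 - x / 2

/-- Example 1.9: `f` on `X = (1/4, 1]`. -/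
noncomputable def f15 : ℝ → ℝ := fun x => if x < 2 / 3 then 1 else 4 / 3 - x

/-- Example 1.9: `g` on `X = (1/4, 1]`. -/
noncomputable def g15 : ℝ → ℝ := fun x => if x < 2 / 3 then 1 / 3 else 4 / 3 - x

theorem le_sub_sq_div_one_add {a t : ℝ} (ht : 0 ≤ t) (ht1 : t ≤ 1) (ha : a ≤ t / 2) :
    a ≤ t - t ^ 2 / (1 + t) := by
  have h : t - t ^ 2 / (1 + t) = t / (1 + t) := by
    field_simp
    ring
  rw [h]
  exact ha.trans (div_le_div_of_nonneg_left ht (by linarith) (by linarith))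

theorem abs_T15_sub_le {x y : ℝ} (hx : x ≤ 1) (hy : y ≤ 1) :
    |T15 x - T15 y| ≤ |f15 x - g15 y| / 2 ∧ |f15 x - g15 y| ≤ 1 := by
  unfold T15 f15 g15
  split_ifs <;> constructor <;> grind

/-- Example 1.9: `T` is `(f,g)`-weakly contractive with `ψ(t) = t²/(1+t)` on
`X = (1/4,1]`, but for every `ψ ∈ Ψ` the Azam–Shakeel inequality
`d(gx,Ty) ≤ d(fx,fy) − ψ(d(fx,fy))` fails at some `x, y ∈ X`. -/
theorem example_1_9 :
    let S : Set ℝ := Set.Ioc (1 / 4) 1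
    let ψ₀ : ℝ → ℝ := fun t => t ^ 2 / (1 + t)
    (∀ x ∈ S, ∀ y ∈ S, |T15 x - T15 y| ≤
      min (|f15 x - g15 y| - ψ₀ |f15 x - g15 y|) (|g15 x - f15 y| - ψ₀ |g15 x - f15 y|)) ∧
    (∀ ψ : ℝ → ℝ, IsPsi ψ → ∃ x ∈ S, ∃ y ∈ S,
      |f15 x - f15 y| - ψ |f15 x - f15 y| < |g15 x - T15 y|) := by
  intro S ψ₀
  refine ⟨fun x hx y hy => le_min ?_ ?_, fun ψ hψ => ?_⟩
  · obtain ⟨h, h1⟩ := abs_T15_sub_le hx.2 hy.2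
    exact le_sub_sq_div_one_add (abs_nonneg _) h1 h
  · obtain ⟨h, h1⟩ := abs_T15_sub_le hy.2 hx.2
    rw [abs_sub_comm (T15 x), abs_sub_comm (g15 x)]
    exact le_sub_sq_div_one_add (abs_nonneg _) h1 h
  · have hmem : (1 / 2 : ℝ) ∈ S := by constructor <;> norm_num
    refine ⟨1 / 2, hmem, 1 / 2, hmem, ?_⟩
    rw [sub_self, abs_zero, hψ.2.2.2.2.1, sub_zero, abs_pos]
    norm_num [g15, T15]
end

section
/- Let (X,d) be a metric space, let T, f, g be selfmaps of X with T (f,g)-weakly contractive, T(X) ⊆ f(X) and T(X) ⊆ g(X). Let x₀ ∈ X and let (x_n) be a sequence with y_{2n} = T(x_{2n}) = f(x_{2n+1}) and y_{2n+1} = T(x_{2n+1}) = g(x_{2n+2}) for all n ≥ 0. Then d(y_n, y_{n+1}) ≤ d(y_{n−1}, y_n) − ψ(d(y_{n−1}, y_n)) for all n ≥ 1, and d(y_n, y_{n+1}) → 0 as n → ∞. -/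
open Set Filter Metric Topology

/-- A pair of selfmaps is weakly compatible if they commute at coincidence points. -/
def WeaklyCompatible {X : Type*} (T f : X → X) : Prop :=
  ∀ x, T x = f x → T (f x) = f (T x)

/-- `T` is `(f,g)`-weakly contractive with respect to `ψ`. -/
def FGWeaklyContractiveWith {X : Type*} [MetricSpace X] (T f g : X → X) (ψ : ℝ → ℝ) : Prop :=
  ∀ x y : X, dist (T x) (T y) ≤
    min (dist (f x) (g y) - ψ (dist (f x) (g y)))
        (dist (g x) (f y) - ψ (dist (g x) (f y)))

/-- A nonnegative real sequence with `a (n + 1) ≤ a n - ψ (a n)` for some `ψ` in the class Ψ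
tends to zero. -/
theorem IsPsi.tendsto_zero_of_succ_le {ψ : ℝ → ℝ} (hψ : IsPsi ψ) {a : ℕ → ℝ}
    (ha : ∀ n, 0 ≤ a n) (hstep : ∀ n, a (n + 1) ≤ a n - ψ (a n)) :
    Tendsto a atTop (𝓝 0) := by
  obtain ⟨hcont, -, hnonneg, hpos, -, -⟩ := hψ
  have hanti : Antitone a := antitone_nat_of_succ_le fun n => by
    linarith [hstep n, hnonneg (a n) (ha n)]
  have hlim : Tendsto a atTop (𝓝 (⨅ n, a n)) :=
    tendsto_atTop_ciInf hanti ⟨0, by rintro _ ⟨n, rfl⟩; exact ha n⟩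
  have hL : 0 ≤ ⨅ n, a n := le_ciInf ha
  generalize (⨅ n, a n) = L at hlim hL
  have hψlim : Tendsto (fun n => ψ (a n)) atTop (𝓝 (ψ L)) :=
    (hcont L hL).tendsto.comp (tendsto_nhdsWithin_iff.2 ⟨hlim, Eventually.of_forall ha⟩)
  have hle : L ≤ L - ψ L :=
    le_of_tendsto_of_tendsto' (hlim.comp (tendsto_add_atTop_nat 1)) (hlim.sub hψlim) hstep
  obtain rfl | hLpos := hL.eq_or_lt
  · exact hlim
  · linarith [hpos L hLpos]

/-- The key intermediate estimate in the proof of Theorem 2.1: the consecutive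
distances of the iteration sequence satisfy the ψ-decrease inequality and tend to 0. -/
theorem iteration_distances_decrease_to_zero
    {X : Type*} [MetricSpace X] (T f g : X → X) (ψ : ℝ → ℝ)
    (hψ : IsPsi ψ) (hcontr : FGWeaklyContractiveWith T f g ψ)
    (h1 : Set.range T ⊆ Set.range f) (h2 : Set.range T ⊆ Set.range g)
    (x₀ : X) (x y : ℕ → X) (hx₀ : x 0 = x₀)
    (he : ∀ n : ℕ, y (2 * n) = T (x (2 * n)) ∧ T (x (2 * n)) = f (x (2 * n + 1)))
    (ho : ∀ n : ℕ, y (2 * n + 1) = T (x (2 * n + 1)) ∧ T (x (2 * n + 1)) = g (x (2 * n + 2))) :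
    (∀ n : ℕ, 1 ≤ n → dist (y n) (y (n + 1)) ≤
      dist (y (n - 1)) (y n) - ψ (dist (y (n - 1)) (y n))) ∧
    Filter.Tendsto (fun n => dist (y n) (y (n + 1))) Filter.atTop (nhds 0) := by
  have hstep : ∀ n : ℕ, dist (y (n + 1)) (y (n + 2)) ≤
      dist (y n) (y (n + 1)) - ψ (dist (y n) (y (n + 1))) := by
    intro n
    obtain ⟨k, rfl | rfl⟩ := n.even_or_odd'
    all_goals have hy : y (2 * k + 2) = T (x (2 * k + 2)) := (he (k + 1)).1
    · have h := (hcontr (x (2 * k + 1)) (x (2 * k + 2))).trans (min_le_left _ _)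
      rwa [← (he k).2, ← (ho k).2, ← (he k).1, ← (ho k).1, ← hy] at h
    · have h := (hcontr (x (2 * k + 2)) (x (2 * k + 3))).trans (min_le_right _ _)
      have hf : T (x (2 * k + 2)) = f (x (2 * k + 3)) := (he (k + 1)).2
      have hy' : y (2 * k + 3) = T (x (2 * k + 3)) := (ho (k + 1)).1
      rwa [← (ho k).2, ← hf, ← (ho k).1, ← hy, ← hy'] at h
  refine ⟨fun n hn => ?_, hψ.tendsto_zero_of_succ_le (fun _ => dist_nonneg) hstep⟩
  obtain ⟨m, rfl⟩ := Nat.exists_eq_add_of_le' hn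
  exact hstep m
end

section
/- Let (X,d) be a metric space, let T, f, g be selfmaps of X with T (f,g)-weakly contractive, T(X) ⊆ f(X) and T(X) ⊆ g(X). Let x₀ ∈ X and let (x_n) be a sequence with y_{2n} = T(x_{2n}) = f(x_{2n+1}) and y_{2n+1} = T(x_{2n+1}) = g(x_{2n+2}) for all n ≥ 0. Then the sequence (y_n) is a Cauchy sequence in X. -/
open Set Filter Metric Topology

/-- If one application of the contraction controls pairs of indices of opposite parity, then the
sequence is Cauchy. -/
lemma cauchySeq_of_odd_gap_weakly_contractive {X : Type*} [MetricSpace X] {ψ : ℝ → ℝ}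
    (hmono : MonotoneOn ψ (Set.Ici 0)) (hnonneg : ∀ t ∈ Set.Ici (0 : ℝ), 0 ≤ ψ t)
    (hpos : ∀ t : ℝ, 0 < t → 0 < ψ t) {y : ℕ → X}
    (hy : ∀ m k : ℕ, dist (y (m + 1)) (y (m + (2 * k + 1) + 1)) ≤
      dist (y m) (y (m + (2 * k + 1))) - ψ (dist (y m) (y (m + (2 * k + 1))))) :
    CauchySeq y := by
  have hstep : ∀ m, dist (y (m + 1)) (y (m + 2)) ≤
      dist (y m) (y (m + 1)) - ψ (dist (y m) (y (m + 1))) := fun m => hy m 0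
  have hanti : Antitone fun n => dist (y n) (y (n + 1)) :=
    antitone_nat_of_succ_le fun n => by
      have h := hstep n
      have h' := hnonneg _ (dist_nonneg (x := y n) (y := y (n + 1)))
      change dist (y (n + 1)) (y (n + 2)) ≤ dist (y n) (y (n + 1))
      linarith
  have hsmall : ∀ δ : ℝ, 0 < δ → ∃ N, ∀ n ≥ N, dist (y n) (y (n + 1)) < δ := by
    intro δ hδ
    suffices ∃ N, dist (y N) (y (N + 1)) < δ from
      this.imp fun N hN n hn => (hanti hn).trans_lt hN
    by_contra! hall
    have hbound : ∀ n : ℕ, dist (y n) (y (n + 1)) ≤ dist (y 0) (y 1) - n * ψ δ := by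
      intro n
      induction n with
      | zero => simp
      | succ n ih =>
        have h := hstep n
        have h' := hmono (Set.mem_Ici.2 hδ.le) (Set.mem_Ici.2 dist_nonneg) (hall n)
        push_cast
        change dist (y (n + 1)) (y (n + 2)) ≤ _
        linarith
    obtain ⟨n, hn⟩ := exists_nat_gt (dist (y 0) (y 1) / ψ δ)
    rw [div_lt_iff₀ (hpos δ hδ)] at hn
    have h := hbound n
    have h' : 0 ≤ dist (y n) (y (n + 1)) := dist_nonneg
    linarith
  rw [Metric.cauchySeq_iff']
  intro ε' hε'
  obtain ⟨ε, hε, rfl⟩ : ∃ ε : ℝ, 0 < ε ∧ ε' = 2 * ε := ⟨ε' / 2, by linarith, by ring⟩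
  have hψε := hpos (ε / 2) (by linarith)
  obtain ⟨N, hN⟩ := hsmall (min (ε / 4) (ψ (ε / 2) / 2)) (lt_min (by linarith) (by linarith))
  have hN₁ : ∀ n ≥ N, dist (y n) (y (n + 1)) < ε / 4 :=
    fun n hn => (hN n hn).trans_le (min_le_left _ _)
  have hN₂ : ∀ n ≥ N, dist (y n) (y (n + 1)) < ψ (ε / 2) / 2 :=
    fun n hn => (hN n hn).trans_le (min_le_right _ _)
  have hodd : ∀ k, dist (y N) (y (N + (2 * k + 1))) < ε := by
    intro k
    induction k with
    | zero => exact (hN₁ N le_rfl).trans (by linarith)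
    | succ k ih =>
      have htri := dist_triangle4 (y N) (y (N + 1)) (y (N + (2 * k + 1) + 1))
        (y (N + (2 * k + 1) + 1 + 1))
      have hc := hy N k
      have a₁ := hN₁ N le_rfl
      have a₂ := hN₂ N le_rfl
      have b₁ := hN₁ (N + (2 * k + 1) + 1) (by omega)
      have b₂ := hN₂ (N + (2 * k + 1) + 1) (by omega)
      rw [show N + (2 * (k + 1) + 1) = N + (2 * k + 1) + 1 + 1 by ring]
      rcases le_total (ε / 2) (dist (y N) (y (N + (2 * k + 1)))) with h | h
      · have := hmono (Set.mem_Ici.2 (by linarith)) (Set.mem_Ici.2 dist_nonneg) h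
        linarith
      · have := hnonneg _ (dist_nonneg (x := y N) (y := y (N + (2 * k + 1))))
        linarith
  refine ⟨N, fun n hn => ?_⟩
  obtain ⟨j, rfl⟩ := Nat.exists_eq_add_of_le hn
  rw [dist_comm]
  rcases Nat.even_or_odd' j with ⟨k, rfl | rfl⟩
  · have h := hodd k
    have h' := hN₁ (N + 2 * k) (by omega)
    have htri := dist_triangle_right (y N) (y (N + 2 * k)) (y (N + 2 * k + 1))
    rw [← add_assoc] at h
    linarith
  · linarith [hodd k]

/-- The Cauchy-sequence step in the proof of Theorem 2.1: the iteration sequence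
`(yₙ)` is Cauchy. -/
theorem iteration_sequence_cauchy
    {X : Type*} [MetricSpace X] (T f g : X → X) (ψ : ℝ → ℝ)
    (hψ : IsPsi ψ) (hcontr : FGWeaklyContractiveWith T f g ψ)
    (h1 : Set.range T ⊆ Set.range f) (h2 : Set.range T ⊆ Set.range g)
    (x₀ : X) (x y : ℕ → X) (hx₀ : x 0 = x₀)
    (he : ∀ n : ℕ, y (2 * n) = T (x (2 * n)) ∧ T (x (2 * n)) = f (x (2 * n + 1)))
    (ho : ∀ n : ℕ, y (2 * n + 1) = T (x (2 * n + 1)) ∧ T (x (2 * n + 1)) = g (x (2 * n + 2))) :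
    CauchySeq y := by
  obtain ⟨-, hmono, hnonneg, hpos, -, -⟩ := hψ
  refine cauchySeq_of_odd_gap_weakly_contractive hmono hnonneg hpos fun m k => ?_
  have hT : ∀ n, y n = T (x n) := fun n => by
    rcases Nat.even_or_odd' n with ⟨i, rfl | rfl⟩
    exacts [(he i).1, (ho i).1]
  have hf : ∀ i, y (2 * i) = f (x (2 * i + 1)) := fun i => (he i).1.trans (he i).2
  have hg : ∀ i, y (2 * i + 1) = g (x (2 * i + 1 + 1)) := fun i => (ho i).1.trans (ho i).2
  have h := hcontr (x (m + 1)) (x (m + (2 * k + 1) + 1))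
  rw [← hT, ← hT] at h
  rcases Nat.even_or_odd' m with ⟨i, rfl | rfl⟩
  · have h' := h.trans (min_le_left _ _)
    have e : 2 * i + (2 * k + 1) = 2 * (i + k) + 1 := by ring
    rw [e] at h' ⊢
    rwa [← hf, ← hg] at h'
  · have h' := h.trans (min_le_right _ _)
    have e : 2 * i + 1 + (2 * k + 1) = 2 * (i + k + 1) := by ring
    rw [e] at h' ⊢
    rwa [← hf, ← hg] at h'
end

section
/- Let (X,d) be a metric space and let T, f, g be selfmaps of X such that T is (f,g)-weakly contractive. If z ∈ X satisfies Tz = fz = gz (z is a coincidence point with common coincidence value w = Tz) and the pairs (T,f) and (T,g) are weakly compatible, then any point z with fz = gz = Tz and such that there exists u with Tu = fu = z and v with Tv = gv = z is a common fixed point: Tz = z. Moreover, a common fixed point of T, f and g, if it exists, is unique. -/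
open Set Filter Metric Topology

/-- If `T x = f x = a` and `T y = g y = b` for an `(f,g)`-weakly contractive `T`, then `a = b`. -/
theorem FGWeaklyContractiveWith.map_eq_of_coincidence {X : Type*} [MetricSpace X]
    {T f g : X → X} {ψ : ℝ → ℝ} (hT : FGWeaklyContractiveWith T f g ψ)
    (hψ : ∀ t : ℝ, 0 < t → 0 < ψ t) {x y : X} (hx : T x = f x) (hy : T y = g y) :
    T x = T y := by
  by_contra hne
  have hle := (hT x y).trans (min_le_left _ _)
  rw [← hx, ← hy] at hle
  linarith [hψ _ (dist_pos.mpr hne)]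

/-- The coincidence-to-fixed-point and uniqueness steps in the proof of Theorem 2.1:
a common coincidence value `z` (with `Tu = fu = z` and `Tv = gv = z`) of weakly
compatible pairs is a common fixed point of `T`, and a common fixed point of
`T`, `f`, `g`, if it exists, is unique. -/
theorem coincidence_point_is_fixed_and_unique
    {X : Type*} [MetricSpace X] (T f g : X → X)
    (hcontr : ∃ ψ : ℝ → ℝ, IsPsi ψ ∧ FGWeaklyContractiveWith T f g ψ)
    (hTf : WeaklyCompatible T f) (hTg : WeaklyCompatible T g) :
    (∀ z : X, T z = f z → f z = g z →
      (∃ u : X, T u = z ∧ f u = z) → (∃ v : X, T v = z ∧ g v = z) → T z = z) ∧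
    (∀ z₁ z₂ : X, (T z₁ = z₁ ∧ f z₁ = z₁ ∧ g z₁ = z₁) →
      (T z₂ = z₂ ∧ f z₂ = z₂ ∧ g z₂ = z₂) → z₁ = z₂) := by
  obtain ⟨ψ, ⟨-, -, -, hψ, -, -⟩, hT⟩ := hcontr
  refine ⟨?_, ?_⟩
  · rintro z hz - - ⟨v, hTv, hgv⟩
    exact (hT.map_eq_of_coincidence hψ hz (hTv.trans hgv.symm)).trans hTv
  · rintro z₁ z₂ ⟨hT₁, hf₁, -⟩ ⟨hT₂, -, hg₂⟩
    have h := hT.map_eq_of_coincidence hψ (hT₁.trans hf₁.symm) (hT₂.trans hg₂.symm)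
    rwa [hT₁, hT₂] at h
end
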